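/- Let Ω ⊂ ℝ² be open and bounded, let ε > 0, and let u : εℒ → S¹ be a spin field. Let P be the set of ε-triangles T ⊆ Ω with χ(u, T) > 0 for which there exists an ε-triangle T′ ⊆ Ω with ℋ¹(T ∩ T′) = ε and χ(u, T′) ≤ 0. Then P is finite and (5/3)·ε·#P ≤ 3·F_ε(u, Ω), i.e. #P ≤ (9/(5ε))·F_ε(u, Ω). -/

import Mathlib

open Real MeasureTheory
open scoped Pointwise

noncomputable section

/-- The plane `ℝ²` with the Euclidean structure. -/
abbrev E2 := EuclideanSpace ℝ (Fin 2)

/-- The lattice direction `ê₁ = (1,0)`. -/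
def e1 : E2 := (WithLp.equiv 2 (Fin 2 → ℝ)).symm ![1, 0]

/-- The lattice direction `ê₂ = (1/2, √3/2)`. -/
def e2 : E2 := (WithLp.equiv 2 (Fin 2 → ℝ)).symm ![1 / 2, Real.sqrt 3 / 2]

/-- The lattice direction `ê₃ = (-1/2, √3/2)`. -/
def e3 : E2 := (WithLp.equiv 2 (Fin 2 → ℝ)).symm ![-(1 / 2), Real.sqrt 3 / 2]

/-- The triangular lattice `ℒ = {z₁ê₁ + z₂ê₂ : z₁, z₂ ∈ ℤ}`. -/
def TriLat : Set E2 := {x | ∃ z₁ z₂ : ℤ, x = (z₁ : ℝ) • e1 + (z₂ : ℝ) • e2}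

/-- The sublattice `ℒ¹ = {z₁(ê₁+ê₂) + z₂(ê₂+ê₃) : z₁, z₂ ∈ ℤ}`. -/
def TriLat1 : Set E2 := {x | ∃ z₁ z₂ : ℤ, x = (z₁ : ℝ) • (e1 + e2) + (z₂ : ℝ) • (e2 + e3)}

/-- The sublattice `ℒ² = ℒ¹ + ê₁`. -/
def TriLat2 : Set E2 := {x | ∃ y ∈ TriLat1, x = y + e1}

/-- The sublattice `ℒ³ = ℒ¹ + ê₂`. -/
def TriLat3 : Set E2 := {x | ∃ y ∈ TriLat1, x = y + e2}

/-- A (unit) triangle of the triangular lattice, with vertices `i ∈ ℒ¹`, `j ∈ ℒ²`,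
`k ∈ ℒ³` at pairwise distance `1`. -/
structure Tri where
  i : E2
  j : E2
  k : E2
  hi : i ∈ TriLat1
  hj : j ∈ TriLat2
  hk : k ∈ TriLat3
  dij : ‖i - j‖ = 1
  djk : ‖j - k‖ = 1
  dki : ‖k - i‖ = 1

/-- The `ε`-triangle `conv{εi, εj, εk}` associated with a unit triangle. -/
def Tri.set (ε : ℝ) (T : Tri) : Set E2 := convexHull ℝ {ε • T.i, ε • T.j, ε • T.k}

/-- The scalar cross product `a × b = a₁b₂ - a₂b₁`. -/
def cross (a b : E2) : ℝ := a 0 * b 1 - a 1 * b 0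

/-- The chirality `χ(u, T)` of the spin field `u` on the `ε`-triangle `T`. -/
def chi (ε : ℝ) (u : E2 → E2) (T : Tri) : ℝ :=
  2 / (3 * Real.sqrt 3) *
    (cross (u (ε • T.i)) (u (ε • T.j)) + cross (u (ε • T.j)) (u (ε • T.k)) +
      cross (u (ε • T.k)) (u (ε • T.i)))

/-- The energy `F_ε(u, T) = ε|u(εi) + u(εj) + u(εk)|²` of one `ε`-triangle. -/
def triEnergy (ε : ℝ) (u : E2 → E2) (T : Tri) : ℝ :=
  ε * ‖u (ε • T.i) + u (ε • T.j) + u (ε • T.k)‖ ^ 2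

/-- The energy `F_ε(u, A)`, the sum of the energies of all `ε`-triangles contained in `A`. -/
def F (ε : ℝ) (u : E2 → E2) (A : Set E2) : ℝ :=
  ∑' T : {T : Tri // Tri.set ε T ⊆ A}, triEnergy ε u T

end

/-- The lattice point with integer coordinates `(m, n)` in the basis `(ê₁, ê₂)`. -/
noncomputable def latPt (m n : ℤ) : E2 := (m : ℝ) • e1 + (n : ℝ) • e2

lemma latPt_zero (m n : ℤ) : latPt m n 0 = m + n / 2 := by
  simp [latPt, e1, e2]; ring

lemma latPt_one (m n : ℤ) : latPt m n 1 = n * (√3 / 2) := by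
  simp [latPt, e1, e2]

lemma latPt_sub (m n m' n' : ℤ) : latPt m n - latPt m' n' = latPt (m - m') (n - n') := by
  simp only [latPt]; push_cast; module

lemma norm_latPt_sq (m n : ℤ) : ‖latPt m n‖ ^ 2 = m ^ 2 + m * n + n ^ 2 := by
  rw [EuclideanSpace.real_norm_sq_eq, Fin.sum_univ_two, latPt_zero, latPt_one]
  have h : √(3 : ℝ) ^ 2 = 3 := Real.sq_sqrt (by norm_num)
  linear_combination (n ^ 2 / 4 : ℝ) * h

lemma latPt_mem (m n : ℤ) : latPt m n ∈ TriLat := ⟨m, n, rfl⟩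

lemma e3_eq : e3 = e2 - e1 := by
  ext x
  fin_cases x
  · norm_num [e1, e2, e3]
  · simp [e1, e2, e3]

lemma exists_latPt_of_mem_triLat1 {x : E2} (hx : x ∈ TriLat1) :
    ∃ m n : ℤ, x = latPt m n ∧ (3 : ℤ) ∣ m - n := by
  obtain ⟨p, q, rfl⟩ := hx
  refine ⟨p - q, p + 2 * q, ?_, ⟨-q, by ring⟩⟩
  rw [e3_eq, latPt]; push_cast; module

lemma exists_latPt_of_mem_triLat2 {x : E2} (hx : x ∈ TriLat2) :
    ∃ m n : ℤ, x = latPt m n ∧ (3 : ℤ) ∣ m - n - 1 := by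
  obtain ⟨y, hy, rfl⟩ := hx
  obtain ⟨m, n, rfl, h⟩ := exists_latPt_of_mem_triLat1 hy
  refine ⟨m + 1, n, ?_, by omega⟩
  simp only [latPt]; push_cast; module

lemma exists_latPt_of_mem_triLat3 {x : E2} (hx : x ∈ TriLat3) :
    ∃ m n : ℤ, x = latPt m n ∧ (3 : ℤ) ∣ m - n + 1 := by
  obtain ⟨y, hy, rfl⟩ := hx
  obtain ⟨m, n, rfl, h⟩ := exists_latPt_of_mem_triLat1 hy
  refine ⟨m, n + 1, ?_, by omega⟩
  simp only [latPt]; push_cast; module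

/-- The unit vectors of the triangular lattice, in integer coordinates. -/
lemma unit_cases_of_norm {m n m' n' : ℤ} (h : ‖latPt m n - latPt m' n'‖ = 1) :
    (m - m' = 1 ∧ n - n' = 0) ∨ (m - m' = -1 ∧ n - n' = 0) ∨ (m - m' = 0 ∧ n - n' = 1) ∨
      (m - m' = 0 ∧ n - n' = -1) ∨ (m - m' = 1 ∧ n - n' = -1) ∨
      (m - m' = -1 ∧ n - n' = 1) := by
  have h2 := norm_latPt_sq (m - m') (n - n')
  rw [← latPt_sub, h] at h2
  generalize m - m' = p at *
  generalize n - n' = q at *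
  have h3 : p ^ 2 + p * q + q ^ 2 = 1 := by
    have : ((p ^ 2 + p * q + q ^ 2 : ℤ) : ℝ) = (1 : ℤ) := by push_cast; linarith
    exact_mod_cast this
  have hp1 : p ≤ 1 := by nlinarith [sq_nonneg (p + 2 * q)]
  have hp2 : -1 ≤ p := by nlinarith [sq_nonneg (p + 2 * q)]
  have hq1 : q ≤ 1 := by nlinarith [sq_nonneg (q + 2 * p)]
  have hq2 : -1 ≤ q := by nlinarith [sq_nonneg (q + 2 * p)]
  interval_cases p <;> interval_cases q <;> simp_all

/-- `(i, j, k)` is a cyclic rotation of `(a, b, c)`. -/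
def IsRotation {α : Type*} (i j k a b c : α) : Prop :=
  (i = a ∧ j = b ∧ k = c) ∨ (i = b ∧ j = c ∧ k = a) ∨ (i = c ∧ j = a ∧ k = b)

/-- Every lattice triangle points up or down, and its labels follow the cyclic order of the
sublattices. -/
lemma Tri.exists_coords (T : Tri) : ∃ i₁ i₂ j₁ j₂ k₁ k₂ : ℤ,
    T.i = latPt i₁ i₂ ∧ T.j = latPt j₁ j₂ ∧ T.k = latPt k₁ k₂ ∧
    (3 : ℤ) ∣ i₁ - i₂ ∧ (3 : ℤ) ∣ j₁ - j₂ - 1 ∧ (3 : ℤ) ∣ k₁ - k₂ + 1 ∧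
    ∃ m n : ℤ,
      IsRotation (i₁, i₂) (j₁, j₂) (k₁, k₂) (m, n) (m + 1, n) (m, n + 1) ∨
      IsRotation (i₁, i₂) (j₁, j₂) (k₁, k₂) (m + 1, n + 1) (m + 1, n) (m, n + 1) := by
  obtain ⟨i₁, i₂, hi, hi'⟩ := exists_latPt_of_mem_triLat1 T.hi
  obtain ⟨j₁, j₂, hj, hj'⟩ := exists_latPt_of_mem_triLat2 T.hj
  obtain ⟨k₁, k₂, hk, hk'⟩ := exists_latPt_of_mem_triLat3 T.hk
  refine ⟨i₁, i₂, j₁, j₂, k₁, k₂, hi, hj, hk, hi', hj', hk', ?_⟩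
  have h1 := T.dij
  have h2 := T.djk
  have h3 := T.dki
  rw [hi, hj] at h1
  rw [hj, hk] at h2
  rw [hk, hi] at h3
  have d1 : (i₁ = j₁ - 1 ∧ i₂ = j₂) ∨ (i₁ = j₁ ∧ i₂ = j₂ + 1) ∨ (i₁ = j₁ + 1 ∧ i₂ = j₂ - 1) := by
    have := unit_cases_of_norm h1
    omega
  have d2 : (j₁ = k₁ - 1 ∧ j₂ = k₂) ∨ (j₁ = k₁ ∧ j₂ = k₂ + 1) ∨ (j₁ = k₁ + 1 ∧ j₂ = k₂ - 1) := by
    have := unit_cases_of_norm h2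
    omega
  have d3 : (k₁ = i₁ - 1 ∧ k₂ = i₂) ∨ (k₁ = i₁ ∧ k₂ = i₂ + 1) ∨ (k₁ = i₁ + 1 ∧ k₂ = i₂ - 1) := by
    have := unit_cases_of_norm h3
    omega
  clear h1 h2 h3 hi hj hk hi' hj' hk'
  simp only [IsRotation, Prod.mk.injEq]
  rcases d1 with d1 | d1 | d1 <;> rcases d2 with d2 | d2 | d2 <;>
  first
  | omega
  | exact ⟨k₁, k₂, by omega⟩
  | exact ⟨k₁ - 1, k₂, by omega⟩
  | exact ⟨k₁, k₂ - 1, by omega⟩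
  | exact ⟨k₁ - 1, k₂ - 1, by omega⟩

/-- The first coordinate of a point in the basis `(ê₁, ê₂)`, rescaled by `ε⁻¹`. -/
noncomputable def latFst (ε : ℝ) : E2 →ₗ[ℝ] ℝ :=
  ε⁻¹ • ((EuclideanSpace.proj (𝕜 := ℝ) (0 : Fin 2)).toLinearMap -
    (√3)⁻¹ • (EuclideanSpace.proj (𝕜 := ℝ) (1 : Fin 2)).toLinearMap)

/-- The second coordinate of a point in the basis `(ê₁, ê₂)`, rescaled by `ε⁻¹`. -/
noncomputable def latSnd (ε : ℝ) : E2 →ₗ[ℝ] ℝ :=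
  ε⁻¹ • ((2 * (√3)⁻¹) • (EuclideanSpace.proj (𝕜 := ℝ) (1 : Fin 2)).toLinearMap)

lemma latFst_smul_latPt {ε : ℝ} (hε : 0 < ε) (m n : ℤ) : latFst ε (ε • latPt m n) = m := by
  have h : √(3 : ℝ) ≠ 0 := by positivity
  simp [latFst, latPt_zero, latPt_one]
  field_simp
  ring

lemma latSnd_smul_latPt {ε : ℝ} (hε : 0 < ε) (m n : ℤ) : latSnd ε (ε • latPt m n) = n := by
  have h : √(3 : ℝ) ≠ 0 := by positivity
  simp [latSnd, latPt_one]
  field_simp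

lemma eq_of_latFst_eq_of_latSnd_eq {ε : ℝ} (hε : 0 < ε) {x y : E2}
    (h1 : latFst ε x = latFst ε y) (h2 : latSnd ε x = latSnd ε y) : x = y := by
  have h : √(3 : ℝ) ≠ 0 := by positivity
  have hsnd : x 1 = y 1 := by simpa [latSnd, hε.ne', h] using h2
  have hfst : x 0 = y 0 := by simpa [latFst, hε.ne', hsnd] using h1
  ext l
  fin_cases l
  · exact hfst
  · exact hsnd

/-- The closed upward lattice triangle of side `ε` with lower left corner `(m, n)`. -/
def upRegion (ε : ℝ) (m n : ℤ) : Set E2 :=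
  {x | m ≤ latFst ε x ∧ n ≤ latSnd ε x ∧ latFst ε x + latSnd ε x ≤ m + n + 1}

/-- The closed downward lattice triangle of side `ε` with upper right corner
`(m + 1, n + 1)`. -/
def downRegion (ε : ℝ) (m n : ℤ) : Set E2 :=
  {x | latFst ε x ≤ m + 1 ∧ latSnd ε x ≤ n + 1 ∧ m + n + 1 ≤ latFst ε x + latSnd ε x}

lemma convex_upRegion (ε : ℝ) (m n : ℤ) : Convex ℝ (upRegion ε m n) :=
  ((convex_Ici (m : ℝ)).linear_preimage (latFst ε)).inter
    (((convex_Ici (n : ℝ)).linear_preimage (latSnd ε)).inter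
      ((convex_Iic (m + n + 1 : ℝ)).linear_preimage (latFst ε + latSnd ε)))

lemma convex_downRegion (ε : ℝ) (m n : ℤ) : Convex ℝ (downRegion ε m n) :=
  ((convex_Iic (m + 1 : ℝ)).linear_preimage (latFst ε)).inter
    (((convex_Iic (n + 1 : ℝ)).linear_preimage (latSnd ε)).inter
      ((convex_Ici (m + n + 1 : ℝ)).linear_preimage (latFst ε + latSnd ε)))

lemma convexHull_subset_upRegion {ε : ℝ} (hε : 0 < ε) {m n i₁ i₂ j₁ j₂ k₁ k₂ : ℤ}
    (h : IsRotation (i₁, i₂) (j₁, j₂) (k₁, k₂) (m, n) (m + 1, n) (m, n + 1)) :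
    convexHull ℝ {ε • latPt i₁ i₂, ε • latPt j₁ j₂, ε • latPt k₁ k₂} ⊆ upRegion ε m n := by
  refine convexHull_min ?_ (convex_upRegion ε m n)
  simp only [Set.insert_subset_iff, Set.singleton_subset_iff, upRegion, Set.mem_ofPred_eq,
    latFst_smul_latPt hε, latSnd_smul_latPt hε]
  norm_cast
  simp only [IsRotation, Prod.mk.injEq] at h
  omega

lemma convexHull_subset_downRegion {ε : ℝ} (hε : 0 < ε) {m n i₁ i₂ j₁ j₂ k₁ k₂ : ℤ}
    (h : IsRotation (i₁, i₂) (j₁, j₂) (k₁, k₂) (m + 1, n + 1) (m + 1, n) (m, n + 1)) :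
    convexHull ℝ {ε • latPt i₁ i₂, ε • latPt j₁ j₂, ε • latPt k₁ k₂} ⊆ downRegion ε m n := by
  refine convexHull_min ?_ (convex_downRegion ε m n)
  simp only [Set.insert_subset_iff, Set.singleton_subset_iff, downRegion, Set.mem_ofPred_eq,
    latFst_smul_latPt hε, latSnd_smul_latPt hε]
  norm_cast
  simp only [IsRotation, Prod.mk.injEq] at h
  omega

lemma upRegion_eq_of_nontrivial {ε : ℝ} (hε : 0 < ε) {m n m' n' : ℤ}
    (h : (upRegion ε m n ∩ upRegion ε m' n').Nontrivial) : m = m' ∧ n = n' := by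
  obtain ⟨x, ⟨⟨a1, a2, a3⟩, b1, b2, b3⟩, y, ⟨⟨c1, c2, c3⟩, d1, d2, d3⟩, hxy⟩ := h
  by_contra hne
  apply hxy
  have hcase : m + 1 ≤ m' ∨ m' + 1 ≤ m ∨ n + 1 ≤ n' ∨ n' + 1 ≤ n := by omega
  apply eq_of_latFst_eq_of_latSnd_eq hε <;>
  rcases hcase with h | h | h | h <;> (rify at h; linarith)

lemma downRegion_eq_of_nontrivial {ε : ℝ} (hε : 0 < ε) {m n m' n' : ℤ}
    (h : (downRegion ε m n ∩ downRegion ε m' n').Nontrivial) : m = m' ∧ n = n' := by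
  obtain ⟨x, ⟨⟨a1, a2, a3⟩, b1, b2, b3⟩, y, ⟨⟨c1, c2, c3⟩, d1, d2, d3⟩, hxy⟩ := h
  by_contra hne
  apply hxy
  have hcase : m + 1 ≤ m' ∨ m' + 1 ≤ m ∨ n + 1 ≤ n' ∨ n' + 1 ≤ n := by omega
  apply eq_of_latFst_eq_of_latSnd_eq hε <;>
  rcases hcase with h | h | h | h <;> (rify at h; linarith)

lemma upRegion_downRegion_of_nontrivial {ε : ℝ} (hε : 0 < ε) {m n m' n' : ℤ}
    (h : (upRegion ε m n ∩ downRegion ε m' n').Nontrivial) :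
    (m' = m ∧ n' = n) ∨ (m' = m - 1 ∧ n' = n) ∨ (m' = m ∧ n' = n - 1) := by
  obtain ⟨x, ⟨⟨a1, a2, a3⟩, b1, b2, b3⟩, y, ⟨⟨c1, c2, c3⟩, d1, d2, d3⟩, hxy⟩ := h
  have h1 : m ≤ m' + 1 := by rify; linarith
  have h2 : n ≤ n' + 1 := by rify; linarith
  have h3 : m' + n' ≤ m + n := by rify; linarith
  by_contra hne
  apply hxy
  have hcase : (m' = m - 1 ∧ n' = n - 1) ∨ (m' = m - 1 ∧ n' = n + 1) ∨
    (m' = m + 1 ∧ n' = n - 1) := by omega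
  apply eq_of_latFst_eq_of_latSnd_eq hε <;>
  rcases hcase with ⟨rfl, rfl⟩ | ⟨rfl, rfl⟩ | ⟨rfl, rfl⟩ <;> (push_cast at *; linarith)

/-- The labels are determined by the cyclically ordered vertices. -/
lemma IsRotation.eq_labels {i₁ i₂ j₁ j₂ k₁ k₂ i₁' i₂' j₁' j₂' k₁' k₂' a₁ a₂ b₁ b₂ c₁ c₂ : ℤ}
    (hT : IsRotation (i₁, i₂) (j₁, j₂) (k₁, k₂) (a₁, a₂) (b₁, b₂) (c₁, c₂))
    (hT' : IsRotation (i₁', i₂') (j₁', j₂') (k₁', k₂') (a₁, a₂) (b₁, b₂) (c₁, c₂))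
    (ci : (3 : ℤ) ∣ i₁ - i₂) (cj : (3 : ℤ) ∣ j₁ - j₂ - 1) (ck : (3 : ℤ) ∣ k₁ - k₂ + 1)
    (ci' : (3 : ℤ) ∣ i₁' - i₂') :
    (i₁ = i₁' ∧ i₂ = i₂') ∧ (j₁ = j₁' ∧ j₂ = j₂') := by
  simp only [IsRotation, Prod.mk.injEq] at hT hT'
  rcases hT with hT | hT | hT <;> rcases hT' with hT' | hT' | hT' <;> omega

/-- The vertices of an upward and of a downward triangle with a common side agree on two
labels. -/
lemma two_labels_of_up_down {i₁ i₂ j₁ j₂ k₁ k₂ i₁' i₂' j₁' j₂' k₁' k₂' m n m' n' : ℤ}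
    (ci : (3 : ℤ) ∣ i₁ - i₂) (ci' : (3 : ℤ) ∣ i₁' - i₂')
    (hT : IsRotation (i₁, i₂) (j₁, j₂) (k₁, k₂) (m, n) (m + 1, n) (m, n + 1))
    (hT' : IsRotation (i₁', i₂') (j₁', j₂') (k₁', k₂') (m' + 1, n' + 1) (m' + 1, n') (m', n' + 1))
    (h : (m' = m ∧ n' = n) ∨ (m' = m - 1 ∧ n' = n) ∨ (m' = m ∧ n' = n - 1)) :
    ((i₁ = i₁' ∧ i₂ = i₂') ∧ (j₁ = j₁' ∧ j₂ = j₂')) ∨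
      ((j₁ = j₁' ∧ j₂ = j₂') ∧ (k₁ = k₁' ∧ k₂ = k₂')) ∨
      ((k₁ = k₁' ∧ k₂ = k₂') ∧ (i₁ = i₁' ∧ i₂ = i₂')) := by
  simp only [IsRotation, Prod.mk.injEq] at hT hT'
  rcases h with ⟨rfl, rfl⟩ | ⟨rfl, rfl⟩ | ⟨rfl, rfl⟩ <;>
  rcases hT with ⟨⟨rfl, rfl⟩, ⟨rfl, rfl⟩, rfl, rfl⟩ | ⟨⟨rfl, rfl⟩, ⟨rfl, rfl⟩, rfl, rfl⟩ |
    ⟨⟨rfl, rfl⟩, ⟨rfl, rfl⟩, rfl, rfl⟩ <;>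
  rcases hT' with ⟨⟨rfl, rfl⟩, ⟨rfl, rfl⟩, rfl, rfl⟩ | ⟨⟨rfl, rfl⟩, ⟨rfl, rfl⟩, rfl, rfl⟩ |
    ⟨⟨rfl, rfl⟩, ⟨rfl, rfl⟩, rfl, rfl⟩ <;>
  omega

/-- Lattice triangles that meet in more than one point share two labelled vertices. -/
lemma Tri.share_side {ε : ℝ} (hε : 0 < ε) {T T' : Tri}
    (h : (Tri.set ε T ∩ Tri.set ε T').Nontrivial) :
    (T.i = T'.i ∧ T.j = T'.j) ∨ (T.j = T'.j ∧ T.k = T'.k) ∨ (T.k = T'.k ∧ T.i = T'.i) := by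
  obtain ⟨i₁, i₂, j₁, j₂, k₁, k₂, hi, hj, hk, ci, cj, ck, m, n, hT⟩ := T.exists_coords
  obtain ⟨i₁', i₂', j₁', j₂', k₁', k₂', hi', hj', hk', ci', cj', ck', m', n', hT'⟩ :=
    T'.exists_coords
  suffices hs : ((i₁ = i₁' ∧ i₂ = i₂') ∧ (j₁ = j₁' ∧ j₂ = j₂')) ∨
      ((j₁ = j₁' ∧ j₂ = j₂') ∧ (k₁ = k₁' ∧ k₂ = k₂')) ∨
      ((k₁ = k₁' ∧ k₂ = k₂') ∧ (i₁ = i₁' ∧ i₂ = i₂')) by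
    rw [hi, hj, hk, hi', hj', hk']
    rcases hs with ⟨⟨rfl, rfl⟩, rfl, rfl⟩ | ⟨⟨rfl, rfl⟩, rfl, rfl⟩ | ⟨⟨rfl, rfl⟩, rfl, rfl⟩ <;>
      simp
  simp only [Tri.set, hi, hj, hk, hi', hj', hk'] at h
  rcases hT with hT | hT <;> rcases hT' with hT' | hT'
  · obtain ⟨rfl, rfl⟩ := upRegion_eq_of_nontrivial hε (h.mono (Set.inter_subset_inter
      (convexHull_subset_upRegion hε hT) (convexHull_subset_upRegion hε hT')))
    exact Or.inl (hT.eq_labels hT' ci cj ck ci')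
  · exact two_labels_of_up_down ci ci' hT hT' (upRegion_downRegion_of_nontrivial hε
      (h.mono (Set.inter_subset_inter
        (convexHull_subset_upRegion hε hT) (convexHull_subset_downRegion hε hT'))))
  · rw [Set.inter_comm] at h
    have := two_labels_of_up_down ci' ci hT' hT (upRegion_downRegion_of_nontrivial hε
      (h.mono (Set.inter_subset_inter
        (convexHull_subset_upRegion hε hT') (convexHull_subset_downRegion hε hT))))
    simpa only [eq_comm] using this
  · obtain ⟨rfl, rfl⟩ := downRegion_eq_of_nontrivial hε (h.mono (Set.inter_subset_inter
      (convexHull_subset_downRegion hε hT) (convexHull_subset_downRegion hε hT')))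
    exact Or.inl (hT.eq_labels hT' ci cj ck ci')

/-- Four unit vectors `a, b, c, d` such that `(a, b, c)` has positive and `(a, b, d)` nonpositive
chirality cannot both be close to balanced. -/
lemma five_thirds_le_of_chirality {a b c d : E2} (ha : ‖a‖ = 1) (hb : ‖b‖ = 1) (hc : ‖c‖ = 1)
    (hd : ‖d‖ = 1) (h1 : 0 < cross a b + cross b c + cross c a)
    (h2 : cross a b + cross b d + cross d a ≤ 0) :
    5 / 3 ≤ ‖a + b + c‖ ^ 2 + ‖a + b + d‖ ^ 2 := by
  have hS := EuclideanSpace.real_norm_sq_eq (a + b)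
  have ha2 := EuclideanSpace.real_norm_sq_eq a
  have hb2 := EuclideanSpace.real_norm_sq_eq b
  have hab := norm_add_sq_real (a + b) c
  have hab' := norm_add_sq_real (a + b) d
  have hcs := neg_le_of_abs_le (abs_real_inner_le_norm (a + b) c)
  have hds := neg_le_of_abs_le (abs_real_inner_le_norm (a + b) d)
  have hci : inner ℝ (a + b) c = (a 0 + b 0) * c 0 + (a 1 + b 1) * c 1 := by
    simp [PiLp.inner_apply, Fin.sum_univ_two]; ring
  have hdi : inner ℝ (a + b) d = (a 0 + b 0) * d 0 + (a 1 + b 1) * d 1 := by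
    simp [PiLp.inner_apply, Fin.sum_univ_two]; ring
  simp only [Fin.sum_univ_two, PiLp.add_apply, ha, hb, hc, hd] at *
  rw [hab, hab']
  have key (p q : ℝ) : ((a 0 + b 0) ^ 2 + (a 1 + b 1) ^ 2) *
      (cross a b + (b 0 * q - b 1 * p) + (p * a 1 - q * a 0)) =
      cross a b * ((a 0 + b 0) ^ 2 + (a 1 + b 1) ^ 2 -
        2 * ((a 0 + b 0) * p + (a 1 + b 1) * q)) := by
    have hD : b 0 ^ 2 + b 1 ^ 2 - a 0 ^ 2 - a 1 ^ 2 = 0 := by linarith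
    simp only [cross]
    linear_combination ((a 0 + b 0) * q - (a 1 + b 1) * p) * hD
  have kc := key (c 0) (c 1)
  have kd := key (d 0) (d 1)
  rw [← hS, ← hci] at kc
  rw [← hS, ← hdi] at kd
  change _ * (cross a b + cross b c + cross c a) = _ at kc
  change _ * (cross a b + cross b d + cross d a) = _ at kd
  generalize inner ℝ (a + b) c = x at *
  generalize inner ℝ (a + b) d = y at *
  have hr := norm_nonneg (a + b)
  generalize ‖a + b‖ = r at *
  rcases hr.eq_or_lt with rfl | hr
  · linarith
  have kc' := mul_pos (pow_pos hr 2) h1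
  have kd' := mul_nonpos_of_nonneg_of_nonpos (pow_pos hr 2).le h2
  rw [kc] at kc'
  rw [kd] at kd'
  rcases pos_and_pos_or_neg_and_neg_of_mul_pos kc' with ⟨hK, _⟩ | ⟨hK, hx⟩
  · have hy : r ^ 2 - 2 * y ≤ 0 := nonpos_of_mul_nonpos_right kd' hK
    nlinarith [sq_nonneg (r - 1 / 3)]
  · nlinarith [sq_nonneg (r - 1 / 3)]

lemma Tri.i_mem (T : Tri) : T.i ∈ TriLat := by
  obtain ⟨m, n, h, -⟩ := exists_latPt_of_mem_triLat1 T.hi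
  exact h ▸ latPt_mem m n

lemma Tri.j_mem (T : Tri) : T.j ∈ TriLat := by
  obtain ⟨m, n, h, -⟩ := exists_latPt_of_mem_triLat2 T.hj
  exact h ▸ latPt_mem m n

lemma Tri.k_mem (T : Tri) : T.k ∈ TriLat := by
  obtain ⟨m, n, h, -⟩ := exists_latPt_of_mem_triLat3 T.hk
  exact h ▸ latPt_mem m n

lemma Tri.eq_of_vertices {T T' : Tri} (hi : T.i = T'.i) (hj : T.j = T'.j) (hk : T.k = T'.k) :
    T = T' := by
  cases T
  cases T'
  simp_all

/-- The energy bound for two lattice triangles sharing a side and of opposite chirality. -/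
lemma five_thirds_le_triEnergy_add {ε : ℝ} (hε : 0 < ε) {u : E2 → E2}
    (hu : ∀ x ∈ TriLat, ‖u (ε • x)‖ = 1) {T T' : Tri}
    (h : (T.i = T'.i ∧ T.j = T'.j) ∨ (T.j = T'.j ∧ T.k = T'.k) ∨ (T.k = T'.k ∧ T.i = T'.i))
    (h1 : 0 < chi ε u T) (h2 : chi ε u T' ≤ 0) :
    5 / 3 * ε ≤ triEnergy ε u T + triEnergy ε u T' := by
  have hc : (0 : ℝ) < 2 / (3 * √3) := by positivity
  have h1 := pos_of_mul_pos_right h1 hc.le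
  have h2 := nonpos_of_mul_nonpos_right h2 hc
  have hi := hu _ T.i_mem
  have hj := hu _ T.j_mem
  have hk := hu _ T.k_mem
  have hi' := hu _ T'.i_mem
  have hj' := hu _ T'.j_mem
  have hk' := hu _ T'.k_mem
  suffices hs : 5 / 3 ≤ ‖u (ε • T.i) + u (ε • T.j) + u (ε • T.k)‖ ^ 2 +
      ‖u (ε • T'.i) + u (ε • T'.j) + u (ε • T'.k)‖ ^ 2 by
    simp only [triEnergy]
    nlinarith
  rcases h with ⟨e, e'⟩ | ⟨e, e'⟩ | ⟨e, e'⟩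
  · rw [← e, ← e'] at h2 ⊢
    exact five_thirds_le_of_chirality hi hj hk hk' h1 h2
  · rw [← e, ← e'] at h2 ⊢
    have := five_thirds_le_of_chirality hj hk hi hi' (by linarith) (by linarith)
    rwa [add_comm _ (u (ε • T.i)), add_comm _ (u (ε • T'.i)), ← add_assoc, ← add_assoc] at this
  · rw [← e, ← e'] at h2 ⊢
    have := five_thirds_le_of_chirality hk hi hj hj' (by linarith) (by linarith)
    rwa [add_assoc, add_comm (u (ε • T.k)), add_assoc (u (ε • T.k)),
      add_comm (u (ε • T.k))] at this

/-- Three points at distance one from both ends of a unit segment cannot be distinct. -/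
lemma apex_eq {p q x y z : E2} (hpq : ‖p - q‖ = 1) (hx : ‖q - x‖ = 1) (hx' : ‖x - p‖ = 1)
    (hy : ‖q - y‖ = 1) (hy' : ‖y - p‖ = 1) (hz : ‖q - z‖ = 1) (hz' : ‖z - p‖ = 1)
    (hxz : x ≠ z) (hyz : y ≠ z) : x = y := by
  have hne : p ≠ q := by
    rintro rfl
    simp at hpq
  rw [← dist_eq_norm] at hx' hy' hz'
  rw [← dist_eq_norm, dist_comm] at hx hy hz
  exact ((EuclideanGeometry.eq_of_dist_eq_of_dist_eq_of_finrank_eq_two (by simp) hne hxz hx' hz'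
    hy' hx hz hy).resolve_right hyz).symm

lemma Tri.eq_of_share_ij {T₁ T₂ T : Tri} (h₁ : T₁.i = T.i ∧ T₁.j = T.j)
    (h₂ : T₂.i = T.i ∧ T₂.j = T.j) (hne₁ : T₁ ≠ T) (hne₂ : T₂ ≠ T) : T₁ = T₂ := by
  refine Tri.eq_of_vertices (h₁.1.trans h₂.1.symm) (h₁.2.trans h₂.2.symm) ?_
  have a₁ := T₁.djk
  have b₁ := T₁.dki
  have a₂ := T₂.djk
  have b₂ := T₂.dki
  rw [h₁.2] at a₁
  rw [h₁.1] at b₁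
  rw [h₂.2] at a₂
  rw [h₂.1] at b₂
  exact apex_eq T.dij a₁ b₁ a₂ b₂ T.djk T.dki
    (fun h => hne₁ (Tri.eq_of_vertices h₁.1 h₁.2 h))
    (fun h => hne₂ (Tri.eq_of_vertices h₂.1 h₂.2 h))

lemma Tri.eq_of_share_jk {T₁ T₂ T : Tri} (h₁ : T₁.j = T.j ∧ T₁.k = T.k)
    (h₂ : T₂.j = T.j ∧ T₂.k = T.k) (hne₁ : T₁ ≠ T) (hne₂ : T₂ ≠ T) : T₁ = T₂ := by
  refine Tri.eq_of_vertices ?_ (h₁.1.trans h₂.1.symm) (h₁.2.trans h₂.2.symm)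
  have a₁ := T₁.dki
  have b₁ := T₁.dij
  have a₂ := T₂.dki
  have b₂ := T₂.dij
  rw [h₁.2] at a₁
  rw [h₁.1] at b₁
  rw [h₂.2] at a₂
  rw [h₂.1] at b₂
  exact apex_eq T.djk a₁ b₁ a₂ b₂ T.dki T.dij
    (fun h => hne₁ (Tri.eq_of_vertices h h₁.1 h₁.2))
    (fun h => hne₂ (Tri.eq_of_vertices h h₂.1 h₂.2))

lemma Tri.eq_of_share_ki {T₁ T₂ T : Tri} (h₁ : T₁.k = T.k ∧ T₁.i = T.i)
    (h₂ : T₂.k = T.k ∧ T₂.i = T.i) (hne₁ : T₁ ≠ T) (hne₂ : T₂ ≠ T) : T₁ = T₂ := by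
  refine Tri.eq_of_vertices (h₁.2.trans h₂.2.symm) ?_ (h₁.1.trans h₂.1.symm)
  have a₁ := T₁.dij
  have b₁ := T₁.djk
  have a₂ := T₂.dij
  have b₂ := T₂.djk
  rw [h₁.2] at a₁
  rw [h₁.1] at b₁
  rw [h₂.2] at a₂
  rw [h₂.1] at b₂
  exact apex_eq T.dki a₁ b₁ a₂ b₂ T.dij T.djk
    (fun h => hne₁ (Tri.eq_of_vertices h₁.2 h h₁.1))
    (fun h => hne₂ (Tri.eq_of_vertices h₂.2 h h₂.1))

lemma finite_triLat_smul_mem {Ω : Set E2} (hΩ : Bornology.IsBounded Ω) {ε : ℝ} (hε : 0 < ε) :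
    {x ∈ TriLat | ε • x ∈ Ω}.Finite := by
  obtain ⟨R, hR⟩ := hΩ.exists_norm_le
  set N : ℤ := ⌈2 * (R / ε)⌉
  refine (((Set.finite_Icc (-N) N).prod (Set.finite_Icc (-N) N)).image
    fun p : ℤ × ℤ => latPt p.1 p.2).subset ?_
  rintro _ ⟨⟨m, n, rfl⟩, hx⟩
  refine ⟨(m, n), ?_, rfl⟩
  have h1 := hR _ hx
  change ‖ε • latPt m n‖ ≤ R at h1
  rw [norm_smul, Real.norm_of_nonneg hε.le, mul_comm, ← le_div_iff₀ hε] at h1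
  have h2 := norm_latPt_sq m n
  have h0 := norm_nonneg (latPt m n)
  have hN : 2 * (R / ε) ≤ N := Int.le_ceil _
  have hm : |(m : ℝ)| ≤ N := by
    refine (abs_le_of_sq_le_sq (b := 2 * ‖latPt m n‖) ?_ (by positivity)).trans (by linarith)
    nlinarith [sq_nonneg (m + 2 * n : ℝ), sq_nonneg (m : ℝ)]
  have hn : |(n : ℝ)| ≤ N := by
    refine (abs_le_of_sq_le_sq (b := 2 * ‖latPt m n‖) ?_ (by positivity)).trans (by linarith)
    nlinarith [sq_nonneg (n + 2 * m : ℝ), sq_nonneg (n : ℝ)]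
  rw [abs_le] at hm hn
  exact ⟨⟨by exact_mod_cast hm.1, by exact_mod_cast hm.2⟩,
    ⟨by exact_mod_cast hn.1, by exact_mod_cast hn.2⟩⟩

lemma finite_tri_subset {Ω : Set E2} (hΩ : Bornology.IsBounded Ω) {ε : ℝ} (hε : 0 < ε) :
    {T : Tri | Tri.set ε T ⊆ Ω}.Finite := by
  have hV := finite_triLat_smul_mem hΩ hε
  refine Set.Finite.of_finite_image (f := fun T : Tri => (T.i, T.j, T.k))
    ((hV.prod (hV.prod hV)).subset ?_) fun T _ T' _ h => ?_
  · rintro _ ⟨T, hT, rfl⟩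
    have hsub := (subset_convexHull ℝ _).trans hT
    exact ⟨⟨T.i_mem, hsub (by simp)⟩, ⟨T.j_mem, hsub (by simp)⟩, T.k_mem, hsub (by simp)⟩
  · simp only [Prod.mk.injEq] at h
    exact Tri.eq_of_vertices h.1 h.2.1 h.2.2

lemma triEnergy_nonneg {ε : ℝ} (hε : 0 < ε) (u : E2 → E2) (T : Tri) : 0 ≤ triEnergy ε u T := by
  unfold triEnergy
  positivity

/-- If `f` sends a finset `P` to `N`, and `f` together with a label in `Fin 3` separates the points
of `P`, then summing a nonnegative `E` over `f` costs at most three times its sum over `N`. -/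
lemma sum_comp_le_three_mul {α : Type*} {P N : Finset α} {f : α → α} {g : α → Fin 3} {E : α → ℝ}
    (hE : ∀ x, 0 ≤ E x) (hf : ∀ x ∈ P, f x ∈ N)
    (hfg : Set.InjOn (fun x => (g x, f x)) P) : ∑ x ∈ P, E (f x) ≤ 3 * ∑ x ∈ N, E x := by
  classical
  calc ∑ x ∈ P, E (f x) = ∑ y ∈ P.image fun x => (g x, f x), E y.2 :=
        (Finset.sum_image hfg (f := fun y : Fin 3 × α => E y.2)).symm
    _ ≤ ∑ y ∈ Finset.univ ×ˢ N, E y.2 := by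
        refine Finset.sum_le_sum_of_subset_of_nonneg ?_ fun _ _ _ => hE _
        intro y hy
        obtain ⟨x, hx, rfl⟩ := Finset.mem_image.1 hy
        simpa using hf x hx
    _ = 3 * ∑ x ∈ N, E x := by simp [Finset.sum_product]

/-- If `P` is the set of `ε`-triangles `T ⊆ Ω` with positive chirality having a neighboring
`ε`-triangle `T' ⊆ Ω` (sharing a side, i.e. `ℋ¹(T ∩ T') = ε`) with nonpositive chirality,
then `P` is finite and `(5/3)·ε·#P ≤ 3·F_ε(u, Ω)`. -/
theorem stmt_17 (Ω : Set E2) (hΩo : IsOpen Ω) (hΩb : Bornology.IsBounded Ω)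
    (ε : ℝ) (hε : 0 < ε) (u : E2 → E2) (hu : ∀ x ∈ TriLat, ‖u (ε • x)‖ = 1) :
    ∀ P : Set Tri,
      P = {T | Tri.set ε T ⊆ Ω ∧ 0 < chi ε u T ∧
        ∃ T' : Tri, Tri.set ε T' ⊆ Ω ∧
          μH[1] (Tri.set ε T ∩ Tri.set ε T') = ENNReal.ofReal ε ∧ chi ε u T' ≤ 0} →
      P.Finite ∧ 5 / 3 * ε * P.ncard ≤ 3 * F ε u Ω := by
  classical
  intro P hP
  have hfin := finite_tri_subset hΩb hε
  have hPsub : P ⊆ {T | Tri.set ε T ⊆ Ω} := by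
    rw [hP]
    exact fun T hT => hT.1
  have hPfin := hfin.subset hPsub
  refine ⟨hPfin, ?_⟩
  have hnbr (T : Tri) : ∃ T' : Tri, ∃ l : Fin 3, T ∈ P →
      Tri.set ε T' ⊆ Ω ∧ chi ε u T' ≤ 0 ∧
      (l = 0 ∧ T.i = T'.i ∧ T.j = T'.j ∨ l = 1 ∧ T.j = T'.j ∧ T.k = T'.k ∨
        l = 2 ∧ T.k = T'.k ∧ T.i = T'.i) := by
    by_cases hT : T ∈ P
    · have hT' := hT
      rw [hP] at hT'
      obtain ⟨-, -, T', hs, hμ, hchi⟩ := hT'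
      have hnt : (Tri.set ε T ∩ Tri.set ε T').Nontrivial := by
        rw [← Set.not_subsingleton_iff]
        intro hsub
        have := Measure.nullSingletonClass_hausdorff E2 (d := 1) one_pos
        rw [hsub.measure_zero] at hμ
        exact (ENNReal.ofReal_pos.2 hε).ne hμ
      rcases Tri.share_side hε hnt with h | h | h
      · exact ⟨T', 0, fun _ => ⟨hs, hchi, Or.inl ⟨rfl, h⟩⟩⟩
      · exact ⟨T', 1, fun _ => ⟨hs, hchi, Or.inr (Or.inl ⟨rfl, h⟩)⟩⟩
      · exact ⟨T', 2, fun _ => ⟨hs, hchi, Or.inr (Or.inr ⟨rfl, h⟩)⟩⟩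
    · exact ⟨T, 0, fun h => absurd h hT⟩
  choose f g hfg using hnbr
  have hpos : ∀ T ∈ P, 0 < chi ε u T := by
    rw [hP]
    exact fun T hT => hT.2.1
  have hne : ∀ T ∈ P, T ≠ f T := fun T hT h =>
    absurd (h ▸ hpos T hT) (hfg T hT).2.1.not_gt
  have hinj : Set.InjOn (fun T => (g T, f T)) P := by
    intro T₁ h₁ T₂ h₂ h
    simp only [Prod.mk.injEq] at h
    obtain ⟨-, -, s₁⟩ := hfg T₁ h₁
    obtain ⟨-, -, s₂⟩ := hfg T₂ h₂
    have n₁ := hne T₁ h₁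
    have n₂ := hne T₂ h₂
    rw [← h.2] at n₂ s₂
    rw [← h.1] at s₂
    rcases s₁ with ⟨l, s₁⟩ | ⟨l, s₁⟩ | ⟨l, s₁⟩ <;> simp [l] at s₂
    · exact Tri.eq_of_share_ij s₁ s₂ n₁ n₂
    · exact Tri.eq_of_share_jk s₁ s₂ n₁ n₂
    · exact Tri.eq_of_share_ki s₁ s₂ n₁ n₂
  set A := hfin.toFinset with hA
  set Q := hPfin.toFinset with hQ
  have hF : F ε u Ω = ∑ T ∈ A, triEnergy ε u T := by
    have : Fintype {T : Tri // Tri.set ε T ⊆ Ω} := hfin.fintype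
    rw [F, tsum_fintype]
    exact (Finset.sum_subtype A (fun T => by simp [hA]) (triEnergy ε u)).symm
  have hQA : Q ⊆ A := by simpa [hA, hQ] using hPsub
  have hsum : ∑ T ∈ Q, triEnergy ε u (f T) ≤ 3 * ∑ T ∈ A \ Q, triEnergy ε u T := by
    refine sum_comp_le_three_mul (triEnergy_nonneg hε u) (fun T hT => ?_)
      (by simpa [hQ] using hinj)
    have hT : T ∈ P := by simpa [hQ] using hT
    obtain ⟨hs, hchi, -⟩ := hfg T hT
    simp only [hA, hQ, Finset.mem_sdiff, Set.Finite.mem_toFinset, Set.mem_ofPred_eq]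
    exact ⟨hs, fun h => absurd (hpos _ h) hchi.not_gt⟩
  have hlow : ∑ _T ∈ Q, 5 / 3 * ε ≤ ∑ T ∈ Q, (triEnergy ε u T + triEnergy ε u (f T)) := by
    refine Finset.sum_le_sum fun T hT => ?_
    have hT : T ∈ P := by simpa [hQ] using hT
    obtain ⟨-, hchi, hs⟩ := hfg T hT
    refine five_thirds_le_triEnergy_add hε hu ?_ (hpos T hT) hchi
    rcases hs with ⟨-, h⟩ | ⟨-, h⟩ | ⟨-, h⟩
    · exact Or.inl h
    · exact Or.inr (Or.inl h)
    · exact Or.inr (Or.inr h)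
  rw [Finset.sum_const, nsmul_eq_mul, Finset.sum_add_distrib] at hlow
  rw [hF, ← Finset.sum_sdiff hQA, Set.ncard_eq_toFinset_card P hPfin]
  have hQ0 : 0 ≤ ∑ T ∈ Q, triEnergy ε u T :=
    Finset.sum_nonneg fun T _ => triEnergy_nonneg hε u T
  linarith
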